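/- Let Ω be a compact topological space, X = C(Ω,ℝ) with the sup-norm, and let T : X → X be order-preserving and commute with the addition of a constant. Then for every x ∈ X, lim_{k→∞} max_{ω∈Ω} (T^k(x)(ω) − x(ω))/k exists and equals inf_{y∈X} max_{ω∈Ω} (T(y)(ω) − y(ω)). -/

import Mathlib

open Filter Topology

section ShapleyOperator

variable {Ω : Type*} [TopologicalSpace Ω]

/-- The maximum of `f - g` is at most `c` if and only if `f ≤ c + g`. -/
lemma iSup_sub_le_iff_le_const_add [CompactSpace Ω] [Nonempty Ω] (f g : C(Ω, ℝ)) (c : ℝ) :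
    (⨆ ω : Ω, (f ω - g ω)) ≤ c ↔ f ≤ ContinuousMap.const Ω c + g := by
  have hbdd : BddAbove (Set.range fun ω => f ω - g ω) :=
    (isCompact_range (by fun_prop)).bddAbove
  rw [ciSup_le_iff hbdd, ContinuousMap.le_def]
  simp

variable {T : C(Ω, ℝ) → C(Ω, ℝ)}

/-- Iterates of a map commuting with constants commute with constants. -/
lemma iterate_const_add
    (hconst : ∀ (c : ℝ) (x : C(Ω, ℝ)),
      T (ContinuousMap.const Ω c + x) = ContinuousMap.const Ω c + T x)
    (k : ℕ) (c : ℝ) (x : C(Ω, ℝ)) :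
    T^[k] (ContinuousMap.const Ω c + x) = ContinuousMap.const Ω c + T^[k] x := by
  induction k with
  | zero => rfl
  | succ k ih => rw [Function.iterate_succ_apply', ih, hconst, Function.iterate_succ_apply']

/-- A sub-eigenvector inequality `T y ≤ c + y` propagates to the iterates. -/
lemma iterate_le_const_mul_add (hmono : Monotone T)
    (hconst : ∀ (c : ℝ) (x : C(Ω, ℝ)),
      T (ContinuousMap.const Ω c + x) = ContinuousMap.const Ω c + T x)
    {c : ℝ} {y : C(Ω, ℝ)} (hy : T y ≤ ContinuousMap.const Ω c + y) (k : ℕ) :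
    T^[k] y ≤ ContinuousMap.const Ω (k * c) + y := by
  induction k with
  | zero => exact ContinuousMap.le_def.mpr fun ω => by simp
  | succ k ih =>
    rw [Function.iterate_succ_apply']
    have h := (hmono ih).trans_eq (hconst _ _)
    rw [ContinuousMap.le_def] at h hy ⊢
    intro ω
    have h₁ := h ω
    have h₂ := hy ω
    simp only [ContinuousMap.add_apply, ContinuousMap.const_apply] at h₁ h₂ ⊢
    push_cast
    linarith

/-- If `T y ≤ c + y`, then the orbit of every `x` grows at rate at most `c`. -/
lemma iSup_iterate_sub_le [CompactSpace Ω] [Nonempty Ω] (hmono : Monotone T)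
    (hconst : ∀ (c : ℝ) (x : C(Ω, ℝ)),
      T (ContinuousMap.const Ω c + x) = ContinuousMap.const Ω c + T x)
    {c : ℝ} {y : C(Ω, ℝ)} (hy : T y ≤ ContinuousMap.const Ω c + y) (x : C(Ω, ℝ)) (k : ℕ) :
    (⨆ ω : Ω, (T^[k] x ω - x ω)) ≤ k * c + 2 * ‖x - y‖ := by
  have hxy (ω : Ω) : |x ω - y ω| ≤ ‖x - y‖ := (x - y).norm_coe_le_norm ω
  have hle : x ≤ ContinuousMap.const Ω ‖x - y‖ + y := ContinuousMap.le_def.mpr fun ω => by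
    have := (abs_le.mp (hxy ω)).2
    simp only [ContinuousMap.add_apply, ContinuousMap.const_apply]
    linarith
  have h := (hmono.iterate k hle).trans_eq (iterate_const_add hconst k _ y)
  refine ciSup_le fun ω => ?_
  have h₁ := ContinuousMap.le_def.mp h ω
  have h₂ := ContinuousMap.le_def.mp (iterate_le_const_mul_add hmono hconst hy k) ω
  have h₃ := (abs_le.mp (hxy ω)).1
  simp only [ContinuousMap.add_apply, ContinuousMap.const_apply] at h₁ h₂
  linarith

/-- If `T^k x ≤ k c + x` with `k` positive, then `⨅ j < k, (T^j x - j c)` is a vector `y`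
with `T y ≤ c + y`. -/
lemma exists_le_const_add_of_iterate_le (hmono : Monotone T)
    (hconst : ∀ (c : ℝ) (x : C(Ω, ℝ)),
      T (ContinuousMap.const Ω c + x) = ContinuousMap.const Ω c + T x)
    {c : ℝ} {x : C(Ω, ℝ)} {k : ℕ} (hk : k ≠ 0)
    (hx : T^[k] x ≤ ContinuousMap.const Ω (k * c) + x) :
    ∃ y, T y ≤ ContinuousMap.const Ω c + y := by
  let u (j : ℕ) : C(Ω, ℝ) := ContinuousMap.const Ω (-(j * c)) + T^[j] x
  have hne : (Finset.range k).Nonempty := Finset.nonempty_range_iff.mpr hk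
  let y := (Finset.range k).inf' hne u
  have hTu (j : ℕ) (hj : j < k) (ω : Ω) : T y ω ≤ c + u (j + 1) ω := by
    have h : T y ≤ T (u j) := hmono (Finset.inf'_le u (Finset.mem_range.mpr hj))
    have h₁ := ContinuousMap.le_def.mp (h.trans_eq (hconst _ _)) ω
    simp only [u, ContinuousMap.add_apply, ContinuousMap.const_apply,
      Function.iterate_succ_apply'] at h₁ ⊢
    push_cast
    linarith
  have hle : ContinuousMap.const Ω (-c) + T y ≤ y := by
    refine Finset.le_inf' _ _ fun j hj => ContinuousMap.le_def.mpr fun ω => ?_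
    have hj := Finset.mem_range.mp hj
    rw [ContinuousMap.add_apply, ContinuousMap.const_apply]
    cases j with
    | zero =>
      have h₁ := hTu (k - 1) (by omega) ω
      have h₂ := ContinuousMap.le_def.mp hx ω
      rw [Nat.sub_add_cancel (by omega)] at h₁
      simp only [u, ContinuousMap.add_apply, ContinuousMap.const_apply] at h₁ h₂ ⊢
      simp only [Nat.cast_zero, zero_mul, Function.iterate_zero, id]
      linarith
    | succ j => linarith [hTu j (by omega) ω]
  refine ⟨y, ContinuousMap.le_def.mpr fun ω => ?_⟩
  have h := ContinuousMap.le_def.mp hle ω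
  simp only [ContinuousMap.add_apply, ContinuousMap.const_apply] at h ⊢
  linarith

/-- The maximum of `T y - y` is bounded below uniformly in `y`. -/
lemma bddBelow_range_iSup_sub [CompactSpace Ω] [Nonempty Ω] (hmono : Monotone T)
    (hconst : ∀ (c : ℝ) (x : C(Ω, ℝ)),
      T (ContinuousMap.const Ω c + x) = ContinuousMap.const Ω c + T x) :
    BddBelow (Set.range fun y : C(Ω, ℝ) => ⨆ ω : Ω, (T y ω - y ω)) := by
  refine ⟨-‖T 0‖, ?_⟩
  rintro _ ⟨y, rfl⟩
  obtain ⟨ω, -, hω⟩ := isCompact_univ.exists_isMinOn Set.univ_nonempty y.continuous.continuousOn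
  have hle : ContinuousMap.const Ω (y ω) + 0 ≤ y := ContinuousMap.le_def.mpr fun z => by
    simpa using hω (Set.mem_univ z)
  have h₁ := ContinuousMap.le_def.mp ((hconst _ _).symm.trans_le (hmono hle)) ω
  have h₂ := (abs_le.mp ((T 0).norm_coe_le_norm ω)).1
  have h₃ := ContinuousMap.le_def.mp
    ((iSup_sub_le_iff_le_const_add (T y) y _).mp le_rfl) ω
  change -‖T 0‖ ≤ ⨆ ω : Ω, (T y ω - y ω)
  simp only [ContinuousMap.add_apply, ContinuousMap.const_apply] at h₁ h₃
  linarith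

end ShapleyOperator

/-- Let `Ω` be a compact topological space, `X = C(Ω, ℝ)` with the
sup-norm, and `T : X → X` order-preserving and commuting with the addition of a
constant.  Then for every `x ∈ X`, the limit of `max_ω (T^k(x)(ω) − x(ω))/k`
exists and equals `inf_y max_ω (T(y)(ω) − y(ω))`. -/
theorem shapley_operator_mean_payoff {Ω : Type*} [TopologicalSpace Ω] [CompactSpace Ω]
    [Nonempty Ω]
    (T : C(Ω, ℝ) → C(Ω, ℝ))
    (hmono : ∀ x y : C(Ω, ℝ), x ≤ y → T x ≤ T y)
    (hconst : ∀ (c : ℝ) (x : C(Ω, ℝ)),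
      T (ContinuousMap.const Ω c + x) = ContinuousMap.const Ω c + T x)
    (x : C(Ω, ℝ)) :
    Tendsto (fun k : ℕ => (⨆ ω : Ω, (T^[k] x ω - x ω)) / (k : ℝ)) atTop
      (𝓝 (⨅ y : C(Ω, ℝ), ⨆ ω : Ω, (T y ω - y ω))) := by
  have hT : Monotone T := hmono
  refine tendsto_order.mpr ⟨fun b hb => ?_, fun b hb => ?_⟩
  · filter_upwards [eventually_ne_atTop 0] with k hk
    have hx := (iSup_sub_le_iff_le_const_add (T^[k] x) x _).mp le_rfl
    rw [← mul_div_cancel₀ (⨆ ω : Ω, (T^[k] x ω - x ω)) (Nat.cast_ne_zero (R := ℝ).mpr hk)] at hx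
    obtain ⟨y, hy⟩ := exists_le_const_add_of_iterate_le hT hconst hk hx
    exact hb.trans_le ((ciInf_le (bddBelow_range_iSup_sub hT hconst) y).trans
      ((iSup_sub_le_iff_le_const_add _ _ _).mpr hy))
  · obtain ⟨y, hy⟩ := exists_lt_of_ciInf_lt hb
    set c := ⨆ ω : Ω, (T y ω - y ω)
    have hTy := (iSup_sub_le_iff_le_const_add (T y) y c).mp le_rfl
    have hlim : Tendsto (fun k : ℕ => c + 2 * ‖x - y‖ / k) atTop (𝓝 c) := by
      simpa using (tendsto_const_div_atTop_nhds_zero_nat (2 * ‖x - y‖)).const_add c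
    filter_upwards [hlim.eventually_lt_const hy, eventually_gt_atTop 0] with k hk hpos
    refine lt_of_le_of_lt ?_ hk
    have hpos : (0 : ℝ) < k := Nat.cast_pos.mpr hpos
    calc (⨆ ω : Ω, (T^[k] x ω - x ω)) / (k : ℝ)
        ≤ (k * c + 2 * ‖x - y‖) / k := by
          gcongr
          exact iSup_iterate_sub_le hT hconst hTy x k
      _ = c + 2 * ‖x - y‖ / k := by field_simp
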